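/- Let A be an r×n matrix over ℚ with column set E such that every r×r minor of A lies in {−1, 0, 1} (for instance, A totally unimodular). Then det(A · Aᵀ) equals the number of bases of A; that is, det(A · Aᵀ) = |{B ⊆ E : |B| = r and det A[B] ≠ 0}|, with the cardinality cast into ℚ. -/

import Mathlib

open Matrix

/-- The square submatrix of `A` formed by the columns in `B` taken in increasing order
(junk value `0` if `B.card ≠ r`). -/
noncomputable def colSub {R : Type*} [CommRing R] {r : ℕ} {E : Type*} [Fintype E] [LinearOrder E]
    (A : Matrix (Fin r) E R) (B : Finset E) : Matrix (Fin r) (Fin r) R :=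
  if h : B.card = r then A.submatrix id (fun i => B.orderEmbOfFin h i) else 0

/-- The set of bases of `A`. -/
noncomputable def bases {r : ℕ} {E : Type*} [Fintype E] [LinearOrder E]
    (A : Matrix (Fin r) E ℚ) : Finset (Finset E) := by
  classical
  exact Finset.univ.filter (fun B => B.card = r ∧ (colSub A B).det ≠ 0)

theorem cb_expand {r : ℕ} {E : Type*} [Fintype E] [LinearOrder E]
    (A : Matrix (Fin r) E ℚ) :
    (A * Aᵀ).det = ∑ p : Fin r → E, (A.submatrix id p).det * ∏ i, A i (p i) := by
  simp only [det_apply', mul_apply, Finset.prod_univ_sum, Finset.mul_sum, Fintype.piFinset_univ,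
    Finset.sum_mul, transpose_apply, submatrix_apply, id]
  rw [Finset.sum_comm]
  refine Finset.sum_congr rfl fun p _ => Finset.sum_congr rfl fun σ _ => ?_
  rw [Finset.prod_mul_distrib, mul_assoc]

theorem cb_fiber {r : ℕ} {E : Type*} [Fintype E] [LinearOrder E]
    (A : Matrix (Fin r) E ℚ) (B : Finset E) (h : B.card = r) :
    ∑ p : Fin r → E with Finset.univ.image p = B, (A.submatrix id p).det * ∏ i, A i (p i)
      = (colSub A B).det ^ 2 := by
  have key : ∑ τ : Equiv.Perm (Fin r), (A.submatrix id (fun i => B.orderEmbOfFin h (τ i))).det *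
      ∏ i, A i (B.orderEmbOfFin h (τ i)) = (colSub A B).det ^ 2 := by
    have h1 : ∀ τ : Equiv.Perm (Fin r), (A.submatrix id (fun i => B.orderEmbOfFin h (τ i))).det
        = (Equiv.Perm.sign τ : ℤ) * (colSub A B).det := by
      intro τ
      rw [← det_permute', colSub, dif_pos h]
      rfl
    simp only [h1]
    have h2 : (colSub A B).det = ∑ τ : Equiv.Perm (Fin r), (Equiv.Perm.sign τ : ℤ) *
        ∏ i, A i (B.orderEmbOfFin h (τ i)) := by
      rw [← det_transpose, det_apply']
      simp only [colSub, dif_pos h, transpose_apply, submatrix_apply, id]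
    rw [sq]
    conv_rhs => lhs; rw [h2]
    rw [Finset.sum_mul]
    refine Finset.sum_congr rfl fun τ _ => ?_
    ring
  rw [← key]
  symm
  refine Finset.sum_bij (fun τ _ i => B.orderEmbOfFin h (τ i)) ?_ ?_ ?_ ?_
  · intro τ _
    simp only [Finset.mem_filter, Finset.mem_univ, true_and]
    apply Finset.eq_of_subset_of_card_le
    · intro x hx
      obtain ⟨i, _, rfl⟩ := Finset.mem_image.1 hx
      exact B.orderEmbOfFin_mem h _
    · have hi : Function.Injective (fun i => B.orderEmbOfFin h (τ i)) :=
        (B.orderEmbOfFin h).injective.comp τ.injective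
      rw [Finset.card_image_of_injective _ hi, h]
      simp
  · intro τ _ σ _ hs
    ext i
    have := congrFun hs i
    simpa using congrArg Fin.val ((B.orderEmbOfFin h).injective this)
  · intro p hp
    simp only [Finset.mem_filter, Finset.mem_univ, true_and] at hp
    have hinj : Function.Injective p := by
      have hc : (Finset.univ.image p).card = (Finset.univ : Finset (Fin r)).card := by
        rw [hp, h]; simp
      have := Finset.card_image_iff.1 hc
      simpa using this
    have hm : ∀ i, p i ∈ B := fun i => hp ▸ Finset.mem_image_of_mem p (Finset.mem_univ i)
    have hi : Function.Injective (fun i => (B.orderIsoOfFin h).symm ⟨p i, hm i⟩) := by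
      intro i j hij
      exact hinj (congrArg Subtype.val ((B.orderIsoOfFin h).symm.injective hij))
    refine ⟨Equiv.ofBijective _ (Finite.injective_iff_bijective.1 hi), Finset.mem_univ _, ?_⟩
    funext i
    simp [← Finset.coe_orderIsoOfFin_apply]
  · intro τ _
    rfl

theorem cb_zero {r : ℕ} {E : Type*} [Fintype E] [LinearOrder E]
    (A : Matrix (Fin r) E ℚ) (B : Finset E) (h : B.card ≠ r) :
    ∑ p : Fin r → E with Finset.univ.image p = B, (A.submatrix id p).det * ∏ i, A i (p i)
      = 0 := by
  refine Finset.sum_eq_zero fun p hp => ?_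
  simp only [Finset.mem_filter, Finset.mem_univ, true_and] at hp
  have : ¬ Function.Injective p := fun hi => h (by
    rw [← hp, Finset.card_image_of_injective _ hi]; simp)
  simp only [Function.Injective, not_forall] at this
  obtain ⟨i, j, hij, hne⟩ := this
  rw [det_zero_of_column_eq hne (fun k => by simp [hij]), zero_mul]

/-- Generalized matrix-tree theorem for regular matroids: if every `r × r` minor of the
`r × n` matrix `A` over `ℚ` lies in `{-1, 0, 1}` (e.g. `A` totally unimodular), then
`det (A * Aᵀ)` equals the number of bases of `A`. -/
theorem matrix_tree_regular {r : ℕ} {E : Type*} [Fintype E] [LinearOrder E]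
    (A : Matrix (Fin r) E ℚ)
    (hA : ∀ B : Finset E, B.card = r →
      (colSub A B).det = -1 ∨ (colSub A B).det = 0 ∨ (colSub A B).det = 1) :
    (A * Aᵀ).det = ((bases A).card : ℚ) := by
  classical
  rw [cb_expand, ← Finset.sum_fiberwise Finset.univ (fun p : Fin r → E => Finset.univ.image p),
    bases, Finset.card_filter]
  push_cast
  refine Finset.sum_congr rfl fun B _ => ?_
  by_cases h : B.card = r
  · rw [cb_fiber A B h]
    rcases hA B h with h' | h' | h' <;> simp [h, h']
  · rw [cb_zero A B h]
    simp [h]
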